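/- arXiv:2501.16633 — 7 statements merged into one kernel-verified Lean document; each statement's English description precedes it below -/
import Mathlib

section
/- Proposition (equivalence (i)⇔(ii)): for formulas φ, θ : L.Formula ℕ and a variable x : ℕ, φ is non-dependent of x in M provided θ if and only if for every valuation v, (θ.Realize v ∧ ∃ b : M, θ.Realize (v[x↦b]) ∧ φ.Realize (v[x↦b])) ↔ (θ.Realize v ∧ φ.Realize v); i.e., the meaning of θ ∧ (∃x∈θ)φ equals the meaning of θ ∧ φ in M. -/
/-- `φ` is non-dependent of variable `x` in `M` provided `θ`. -/
def NonDepProvided {L : FirstOrder.Language} (M : Type*) [L.Structure M]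
    (φ θ : L.Formula ℕ) (x : ℕ) : Prop :=
  ∀ (v : ℕ → M) (b : M), θ.Realize v → θ.Realize (Function.update v x b) →
    (φ.Realize v ↔ φ.Realize (Function.update v x b))

theorem stmt1 {L : FirstOrder.Language} {M : Type*} [L.Structure M] [Nonempty M]
    (φ θ : L.Formula ℕ) (x : ℕ) :
    NonDepProvided M φ θ x ↔
      ∀ v : ℕ → M,
        (θ.Realize v ∧ ∃ b : M, θ.Realize (Function.update v x b) ∧
            φ.Realize (Function.update v x b)) ↔
          (θ.Realize v ∧ φ.Realize v) := by
  constructor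
  · intro h v
    refine and_congr_right fun hθ => ⟨?_, fun hφ => ⟨v x, ?_⟩⟩
    · rintro ⟨b, hθb, hφb⟩
      exact (h v b hθ hθb).2 hφb
    · rw [Function.update_eq_self]
      exact ⟨hθ, hφ⟩
  · intro h v b hθ hθb
    refine ⟨fun hφ => ((h (Function.update v x b)).1 ⟨hθb, v x, ?_⟩).2,
      fun hφb => ((h v).1 ⟨hθ, b, hθb, hφb⟩).2⟩
    rw [Function.update_idem, Function.update_eq_self]
    exact ⟨hθ, hφ⟩
end

section
/- Proposition (equivalence (i)⇔(iii)): for formulas φ, θ : L.Formula ℕ and a variable x : ℕ, φ is non-dependent of x in M provided θ if and only if for every valuation v, (θ.Realize v ∧ ∀ b : M, θ.Realize (v[x↦b]) → φ.Realize (v[x↦b])) ↔ (θ.Realize v ∧ φ.Realize v); i.e., the meaning of θ ∧ (∀x∈θ)φ equals the meaning of θ ∧ φ in M. -/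
theorem stmt2 {L : FirstOrder.Language} {M : Type*} [L.Structure M] [Nonempty M]
    (φ θ : L.Formula ℕ) (x : ℕ) :
    NonDepProvided M φ θ x ↔
      ∀ v : ℕ → M,
        (θ.Realize v ∧ ∀ b : M, θ.Realize (Function.update v x b) →
            φ.Realize (Function.update v x b)) ↔
          (θ.Realize v ∧ φ.Realize v) := by
  constructor
  · intro h v
    refine and_congr_right fun hv => ⟨fun H => ?_, fun H b hb => (h v b hv hb).1 H⟩
    simpa using H (v x) (by simpa using hv)
  · intro h v b hv hb
    refine ⟨fun H => ((h v).2 ⟨hv, H⟩).2 b hb, fun H => ?_⟩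
    simpa using ((h (Function.update v x b)).2 ⟨hb, H⟩).2 (v x) (by simpa using hv)
end

section
/- Proposition (equivalence (i)⇔(iv)): for formulas φ, θ : L.Formula ℕ and a variable x : ℕ, φ is non-dependent of x in M provided θ if and only if for every valuation v, (θ.Realize v → ∀ b : M, θ.Realize (v[x↦b]) → φ.Realize (v[x↦b])) ↔ (θ.Realize v → φ.Realize v); i.e., the meaning of θ → (∀x∈θ)φ equals the meaning of θ → φ in M. -/
theorem stmt3 {L : FirstOrder.Language} {M : Type*} [L.Structure M] [Nonempty M]
    (φ θ : L.Formula ℕ) (x : ℕ) :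
    NonDepProvided M φ θ x ↔
      ∀ v : ℕ → M,
        (θ.Realize v → ∀ b : M, θ.Realize (Function.update v x b) →
            φ.Realize (Function.update v x b)) ↔
          (θ.Realize v → φ.Realize v) := by
  constructor
  · intro h v
    refine ⟨fun hall hv => ?_, fun hφ hv b hb => (h v b hv hb).1 (hφ hv)⟩
    have hφ := hall hv (v x)
    rw [Function.update_eq_self] at hφ
    exact hφ hv
  · intro h v b hv hb
    refine ⟨fun hφ => (h v).2 (fun _ => hφ) hv b hb, fun hφ => ?_⟩
    have hback := (h (Function.update v x b)).2 (fun _ => hφ) hb (v x)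
    rw [Function.update_idem, Function.update_eq_self] at hback
    exact hback hv
end

section
/- Proposition (equivalence (i)⇔(v)): for formulas φ, θ : L.Formula ℕ and a variable x : ℕ, φ is non-dependent of x in M provided θ if and only if for every valuation v, (θ.Realize v → ∃ b : M, θ.Realize (v[x↦b]) ∧ φ.Realize (v[x↦b])) ↔ (θ.Realize v → φ.Realize v); i.e., the meaning of θ → (∃x∈θ)φ equals the meaning of θ → φ in M. -/
theorem stmt4 {L : FirstOrder.Language} {M : Type*} [L.Structure M] [Nonempty M]
    (φ θ : L.Formula ℕ) (x : ℕ) :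
    NonDepProvided M φ θ x ↔
      ∀ v : ℕ → M,
        (θ.Realize v → ∃ b : M, θ.Realize (Function.update v x b) ∧
            φ.Realize (Function.update v x b)) ↔
          (θ.Realize v → φ.Realize v) := by
  constructor
  · refine fun h v => ⟨fun hex hθ => ?_, fun hφ hθ => ⟨v x, ?_⟩⟩
    · obtain ⟨b, hθb, hφb⟩ := hex hθ
      exact (h v b hθ hθb).mpr hφb
    · rw [Function.update_eq_self]
      exact ⟨hθ, hφ hθ⟩
  · refine fun h v b hθ hθb => ⟨fun hφ => ?_, fun hφb => ?_⟩
    · refine (h (Function.update v x b)).mp (fun _ => ⟨v x, ?_⟩) hθb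
      rw [Function.update_idem, Function.update_eq_self]
      exact ⟨hθ, hφ⟩
    · exact (h v).mp (fun _ => ⟨b, hθb, hφb⟩) hθ
end

section
/- Bounded universal quantifiers can be brought out of Boolean combinations: let f : (Fin n → Prop) → Prop respect pointwise logical equivalence, let θ : L.Formula ℕ, x : ℕ, and let φ : Fin n → L.Formula ℕ be formulas each of which is non-dependent of x in M provided θ. Then for every valuation v, ((∃ b : M, θ.Realize (v[x↦b])) → f (fun i => ∀ b : M, θ.Realize (v[x↦b]) → (φ i).Realize (v[x↦b]))) ↔ (∀ b : M, θ.Realize (v[x↦b]) → f (fun i => (φ i).Realize (v[x↦b]))). -/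
/-- `f` models a Boolean combination: it respects pointwise logical equivalence. -/
def RespectsIff {n : ℕ} (f : (Fin n → Prop) → Prop) : Prop :=
  ∀ P Q : Fin n → Prop, (∀ i, P i ↔ Q i) → (f P ↔ f Q)

/-- Under a bound `θ` satisfied at `v[x↦b]`, the bounded universal quantification of a
non-dependent formula is equivalent to its instance at `b`. -/
theorem NonDepProvided.forall_realize_iff {L : FirstOrder.Language} {M : Type*} [L.Structure M]
    {φ θ : L.Formula ℕ} {x : ℕ} (h : NonDepProvided M φ θ x) {v : ℕ → M} {b : M}
    (hb : θ.Realize (Function.update v x b)) :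
    (∀ c : M, θ.Realize (Function.update v x c) → φ.Realize (Function.update v x c)) ↔
      φ.Realize (Function.update v x b) := by
  refine ⟨fun H => H b hb, fun H c hc => ?_⟩
  have hbc := h (Function.update v x b) c hb
  rw [Function.update_idem] at hbc
  exact (hbc hc).1 H

theorem stmt10 {L : FirstOrder.Language} {M : Type*} [L.Structure M] [Nonempty M]
    {n : ℕ} (f : (Fin n → Prop) → Prop) (hf : RespectsIff f)
    (θ : L.Formula ℕ) (x : ℕ) (φ : Fin n → L.Formula ℕ)
    (hφ : ∀ i, NonDepProvided M (φ i) θ x) :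
    ∀ v : ℕ → M,
      ((∃ b : M, θ.Realize (Function.update v x b)) →
          f (fun i => ∀ b : M, θ.Realize (Function.update v x b) →
            (φ i).Realize (Function.update v x b))) ↔
        ∀ b : M, θ.Realize (Function.update v x b) →
          f (fun i => (φ i).Realize (Function.update v x b)) := by
  intro v
  constructor
  · intro H b hb
    exact (hf _ _ fun i => (hφ i).forall_realize_iff hb).1 (H ⟨b, hb⟩)
  · rintro H ⟨b, hb⟩
    exact (hf _ _ fun i => (hφ i).forall_realize_iff hb).2 (H b hb)
end

section
/- Existential version of bringing out a bounded quantifier through a quantifier prefix: let f : (Fin n → Prop) → Prop respect pointwise logical equivalence, let θ : L.Formula ℕ, x : ℕ, let φ : Fin n → L.Formula ℕ each be non-dependent of x in M provided θ, let qs : List (Bool × ℕ) be a quantifier prefix such that every variable z occurring in qs satisfies z ≠ x and is semantically non-occurring in θ, and assume that for every valuation v there exists b : M with θ.Realize (v[x↦b]). Then for every valuation v, Q qs (fun w => f (fun i => ∃ b : M, θ.Realize (w[x↦b]) ∧ (φ i).Realize (w[x↦b]))) v ↔ (∃ b : M, θ.Realize (v[x↦b]) ∧ Q qs (fun w => f (fun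 i => (φ i).Realize w)) (v[x↦b])). -/
/-- Variable `z` is semantically non-occurring in formula `χ` (in `M`). -/
def SemNonOcc {L : FirstOrder.Language} (M : Type*) [L.Structure M]
    (χ : L.Formula ℕ) (z : ℕ) : Prop :=
  ∀ (v : ℕ → M) (b : M), χ.Realize v ↔ χ.Realize (Function.update v z b)

/-- Semantic action of a quantifier prefix: `true` is `∀`, `false` is `∃`. -/
def Q {M : Type*} : List (Bool × ℕ) → ((ℕ → M) → Prop) → (ℕ → M) → Prop
  | [], P => P
  | (true, z) :: rest, P => fun v => ∀ b : M, Q rest P (Function.update v z b)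
  | (false, z) :: rest, P => fun v => ∃ b : M, Q rest P (Function.update v z b)

/-- If `P` at `w` agrees with `R` at `w[x↦b]` for each `w` with `θ` true at `w[x↦b]`, then so do
the predicates obtained by a quantifier prefix whose variables differ from `x` and do not
occur semantically in `θ`. -/
theorem Q_iff_Q_update {L : FirstOrder.Language} {M : Type*} [L.Structure M]
    {θ : L.Formula ℕ} {x : ℕ} {b : M} {P R : (ℕ → M) → Prop}
    (hPR : ∀ w, θ.Realize (Function.update w x b) → (P w ↔ R (Function.update w x b)))
    {qs : List (Bool × ℕ)} (hqs : ∀ p ∈ qs, p.2 ≠ x ∧ SemNonOcc M θ p.2)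
    {v : ℕ → M} (hv : θ.Realize (Function.update v x b)) :
    Q qs P v ↔ Q qs R (Function.update v x b) := by
  induction qs generalizing v with
  | nil => exact hPR v hv
  | cons p rest ih =>
    obtain ⟨q, z⟩ := p
    obtain ⟨hzx, hz⟩ := hqs (q, z) List.mem_cons_self
    have step (c : M) : Q rest P (Function.update v z c) ↔
        Q rest R (Function.update (Function.update v x b) z c) := by
      rw [Function.update_comm hzx.symm]
      refine ih (fun p hp => hqs p (List.mem_cons_of_mem _ hp)) ?_
      rw [Function.update_comm hzx]
      exact (hz _ c).mp hv
    cases q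
    · exact exists_congr step
    · exact forall_congr' step

theorem stmt13 {L : FirstOrder.Language} {M : Type*} [L.Structure M] [Nonempty M]
    {n : ℕ} (f : (Fin n → Prop) → Prop) (hf : RespectsIff f)
    (θ : L.Formula ℕ) (x : ℕ) (φ : Fin n → L.Formula ℕ)
    (hφ : ∀ i, NonDepProvided M (φ i) θ x)
    (qs : List (Bool × ℕ))
    (hqs : ∀ p ∈ qs, p.2 ≠ x ∧ SemNonOcc M θ p.2)
    (hθ : ∀ v : ℕ → M, ∃ b : M, θ.Realize (Function.update v x b)) :
    ∀ v : ℕ → M,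
      Q qs (fun w => f (fun i => ∃ b : M, θ.Realize (Function.update w x b) ∧
          (φ i).Realize (Function.update w x b))) v ↔
        ∃ b : M, θ.Realize (Function.update v x b) ∧
          Q qs (fun w => f (fun i => (φ i).Realize w)) (Function.update v x b) := by
  intro v
  have key (b : M) (hb : θ.Realize (Function.update v x b)) :=
    Q_iff_Q_update (P := fun w => f (fun i => ∃ c : M, θ.Realize (Function.update w x c) ∧
        (φ i).Realize (Function.update w x c)))
      (R := fun w => f (fun i => (φ i).Realize w)) (fun w hw => hf _ _ fun i => by
        refine ⟨fun ⟨c, hc, hφc⟩ => ?_, fun h => ⟨b, hw, h⟩⟩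
        have h := hφ i (Function.update w x c) b hc
        rw [Function.update_idem] at h
        exact (h hw).mp hφc) hqs hb
  constructor
  · intro h
    obtain ⟨b, hb⟩ := hθ v
    exact ⟨b, hb, (key b hb).mp h⟩
  · rintro ⟨b, hb, h⟩
    exact (key b hb).mpr h
end

section
/- Reformulation of non-dependence via substitution: let φ, θ : L.Formula ℕ, let x, y, z : ℕ be pairwise distinct variables such that y and z are each semantically non-occurring in both φ and θ. Then φ is non-dependent of x in M provided θ if and only if for every valuation v, θ.Realize (v[x↦ v y]) → θ.Realize (v[x↦ v z]) → (φ.Realize (v[x↦ v y]) ↔ φ.Realize (v[x↦ v z])). -/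
theorem stmt14 {L : FirstOrder.Language} {M : Type*} [L.Structure M] [Nonempty M]
    (φ θ : L.Formula ℕ) (x y z : ℕ)
    (hxy : x ≠ y) (hxz : x ≠ z) (hyz : y ≠ z)
    (hyφ : SemNonOcc M φ y) (hyθ : SemNonOcc M θ y)
    (hzφ : SemNonOcc M φ z) (hzθ : SemNonOcc M θ z) :
    NonDepProvided M φ θ x ↔
      ∀ v : ℕ → M,
        θ.Realize (Function.update v x (v y)) →
          θ.Realize (Function.update v x (v z)) →
            (φ.Realize (Function.update v x (v y)) ↔
              φ.Realize (Function.update v x (v z))) := by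
  constructor
  · intro h v hy hz
    simpa using h (Function.update v x (v y)) (v z) hy (by simpa using hz)
  · intro h v b hv hb
    have realize_iff {χ : L.Formula ℕ} (hyχ : SemNonOcc M χ y) (hzχ : SemNonOcc M χ z) (c : M) :
        χ.Realize (Function.update (Function.update (Function.update v y (v x)) z b) x c) ↔
          χ.Realize (Function.update v x c) := by
      rw [Function.update_comm hxz.symm, ← hzχ, Function.update_comm hxy.symm, ← hyχ]
    have key := h (Function.update (Function.update v y (v x)) z b)
    simp only [Function.update_self, Function.update_of_ne hyz, realize_iff hyθ hzθ,
      realize_iff hyφ hzφ, Function.update_eq_self] at key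
    exact key hv hb
end
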